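/- arXiv:2510.09552 — 2 statements merged into one kernel-verified Lean document; each statement's English description precedes it below -/
import Mathlib

section
/- Let 0 → Q --α--> P --β--> T → 0 be a short exact sequence of finitely generated free abelian groups. Then the sequence 0 → Λ²Q → Q ⊗ P → S²(P) → S²(T) → 0 is exact, where Λ²Q → Q⊗P sends a∧b to a⊗α(b) − b⊗α(a), Q⊗P → S²(P) sends a⊗p to the product α(a)·p in S²(P), and S²(P) → S²(T) is the map S²(β) induced by β. -/
noncomputable section

open TensorProduct

section Sym2

variable (k : Type*) [CommRing k] (V : Type*) [AddCommGroup V] [Module k V]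

/-- The submodule of `V ⊗ V` generated by the elements `u ⊗ v - v ⊗ u`. -/
def symSub : Submodule k (V ⊗[k] V) :=
  Submodule.span k {w | ∃ u v : V, w = u ⊗ₜ[k] v - v ⊗ₜ[k] u}

/-- The symmetric square `S²(V)`: the quotient of `V ⊗ V` by all `u ⊗ v - v ⊗ u`. -/
abbrev Sym2M : Type _ := (V ⊗[k] V) ⧸ symSub k V

variable {k V}

/-- The product `u·v` in `S²(V)`, i.e. the image of `u ⊗ v`. -/
def symMk (u v : V) : Sym2M k V := Submodule.Quotient.mk (u ⊗ₜ[k] v)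

end Sym2

/-- The wedge `a ∧ b`, an element of the second exterior power `⋀[ℤ]² Q`. -/
def wedge2 {Q : Type*} [AddCommGroup Q] [Module ℤ Q] (a b : Q) : ⋀[ℤ]^2 Q :=
  ⟨ExteriorAlgebra.ιMulti ℤ 2 ![a, b],
    ExteriorAlgebra.ιMulti_range ℤ 2 (Set.mem_range_self _)⟩

section Sym2Lemmas

variable {k : Type*} [CommRing k] {V W M : Type*} [AddCommGroup V] [Module k V]
  [AddCommGroup W] [Module k W] [AddCommGroup M] [Module k M]

/-- The linear map out of `S²(V)` induced by a symmetric bilinear map. -/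
def symLift (B : V →ₗ[k] V →ₗ[k] M) (hB : ∀ u v, B u v = B v u) : Sym2M k V →ₗ[k] M :=
  (symSub k V).liftQ (TensorProduct.lift B) <| Submodule.span_le.2 <| by
    rintro _ ⟨u, v, rfl⟩
    simp [hB u v]

theorem symLift_symMk (B : V →ₗ[k] V →ₗ[k] M) (hB : ∀ u v, B u v = B v u) (u v : V) :
    symLift B hB (symMk u v) = B u v :=
  (Submodule.liftQ_apply _ _ _).trans (TensorProduct.lift.tmul _ _)

/-- The product `V × V → S²(V)` as a bilinear map. -/
def symMul (k : Type*) [CommRing k] (V : Type*) [AddCommGroup V] [Module k V] :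
    V →ₗ[k] V →ₗ[k] Sym2M k V :=
  (TensorProduct.mk k V V).compr₂ (symSub k V).mkQ

theorem symMul_apply (u v : V) : symMul k V u v = symMk u v := rfl

theorem symMk_comm (u v : V) : (symMk u v : Sym2M k V) = symMk v u :=
  (Submodule.Quotient.eq _).2 (Submodule.subset_span ⟨u, v, rfl⟩)

/-- The map `S²(V) → S²(W)` induced by a linear map `V → W`. -/
def symMap (φ : V →ₗ[k] W) : Sym2M k V →ₗ[k] Sym2M k W :=
  symLift ((symMul k W).compl₁₂ φ φ) fun _ _ => symMk_comm _ _

theorem symMap_symMk (φ : V →ₗ[k] W) (u v : V) :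
    symMap φ (symMk u v) = symMk (φ u) (φ v) :=
  symLift_symMk _ _ _ _

theorem sym2_hom_ext {F G : Sym2M k V →ₗ[k] M} (hFG : ∀ u v, F (symMk u v) = G (symMk u v)) :
    F = G :=
  Submodule.linearMap_qext _ (TensorProduct.ext' hFG)

end Sym2Lemmas

section ExteriorSquare

variable {k : Type*} [CommRing k] {Q M : Type*} [AddCommGroup Q] [Module k Q]
  [AddCommGroup M] [Module k M]

/-- For free `Q`, the antisymmetrization `⋀²Q → Q ⊗ Q` is injective. -/
theorem injective_of_exteriorSquare_antisymmetrization [Module.Free k Q]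
    (w : ⋀[k]^2 Q →ₗ[k] Q ⊗[k] Q)
    (hw : ∀ a b : Q, w (exteriorPower.ιMulti k 2 ![a, b]) = a ⊗ₜ[k] b - b ⊗ₜ[k] a) :
    Function.Injective w := by
  classical
  let b := Module.Free.chooseBasis k Q
  let : LinearOrder (Module.Free.ChooseBasisIndex k Q) := linearOrderOfSTO WellOrderingRel
  let e : Q ⊗[k] Q →ₗ[k] ⋀[k]^2 Q := (b.tensorProduct b).constr k fun p =>
    if p.1 < p.2 then exteriorPower.ιMulti k 2 ![b p.1, b p.2] else 0
  have he (i j) : e (b i ⊗ₜ b j) =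
      if i < j then exteriorPower.ιMulti k 2 ![b i, b j] else 0 := by
    rw [← Module.Basis.tensorProduct_apply, Module.Basis.constr_basis]
  have hswap (x y : Q) : exteriorPower.ιMulti k 2 ![y, x] = -exteriorPower.ιMulti k 2 ![x, y] := by
    rw [← (exteriorPower.ιMulti k 2).map_swap ![x, y] (i := 0) (j := 1) (by decide)]
    congr 1
    ext i
    fin_cases i <;> rfl
  have hew : e ∘ₗ w = LinearMap.id := by
    apply exteriorPower.linearMap_ext
    apply AlternatingMap.coe_multilinearMap_injective
    refine Module.Basis.ext_multilinear (fun _ => b) fun v => ?_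
    have hv : (fun i => b (v i)) = ![b (v 0), b (v 1)] := by
      ext i
      fin_cases i <;> rfl
    change e (w (exteriorPower.ιMulti k 2 fun i => b (v i))) =
      exteriorPower.ιMulti k 2 fun i => b (v i)
    rw [hv, hw, map_sub, he, he]
    rcases lt_trichotomy (v 0) (v 1) with hlt | heq | hlt
    · simp [hlt, hlt.not_gt]
    · have h0 : exteriorPower.ιMulti k 2 ![b (v 1), b (v 1)] = 0 :=
        (exteriorPower.ιMulti k 2).map_eq_zero_of_eq _ (i := 0) (j := 1) rfl (by decide)
      rw [heq, h0]
      simp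
    · rw [if_neg hlt.not_gt, if_pos hlt, hswap (b (v 0)) (b (v 1))]
      simp
  exact Function.LeftInverse.injective (g := e) fun x => LinearMap.congr_fun hew x

end ExteriorSquare

section ExactSequence

variable {k : Type*} [CommRing k] {Q P T : Type*} [AddCommGroup Q] [Module k Q]
  [AddCommGroup P] [Module k P] [AddCommGroup T] [Module k T]

/-- The Koszul-type sequence `0 → ⋀²Q → Q ⊗ P → S²(P) → S²(T) → 0` attached to a short exact
sequence `0 → Q → P → T → 0` with `Q` free and `T` projective is exact. -/
theorem sym2_koszul_exact [Module.Free k Q] [Module.Projective k T]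
    (α : Q →ₗ[k] P) (β : P →ₗ[k] T)
    (hα : Function.Injective α) (hβ : Function.Surjective β)
    (hαβ : Function.Exact α β)
    (f : ⋀[k]^2 Q →ₗ[k] Q ⊗[k] P) (g : Q ⊗[k] P →ₗ[k] Sym2M k P)
    (h : Sym2M k P →ₗ[k] Sym2M k T)
    (hf : ∀ a b : Q, f (exteriorPower.ιMulti k 2 ![a, b]) = a ⊗ₜ[k] α b - b ⊗ₜ[k] α a)
    (hg : ∀ (a : Q) (p : P), g (a ⊗ₜ[k] p) = symMk (α a) p)
    (hh : ∀ p p' : P, h (symMk p p') = symMk (β p) (β p')) :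
    Function.Injective f ∧ Function.Exact f g ∧ Function.Exact g h ∧
      Function.Surjective h := by
  obtain ⟨s, hs⟩ := Module.projective_lifting_property β LinearMap.id hβ
  have hβs (t : T) : β (s t) = t := LinearMap.congr_fun hs t
  obtain ⟨r, hr⟩ :=
    ((hαβ.split_tfae hα hβ).out 0 1 :
      (∃ l, β ∘ₗ l = LinearMap.id) ↔ ∃ l, l ∘ₗ α = LinearMap.id).1 ⟨s, hs⟩
  have hrα (a : Q) : r (α a) = a := LinearMap.congr_fun hr a
  have hβα (a : Q) : β (α a) = 0 := hαβ.apply_apply_eq_zero a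
  have hgf : g ∘ₗ f = 0 := by
    apply exteriorPower.linearMap_ext
    ext v
    have hv : v = ![v 0, v 1] := by
      ext i
      fin_cases i <;> rfl
    change g (f (exteriorPower.ιMulti k 2 v)) = 0
    rw [hv, hf, map_sub, hg, hg, symMk_comm, sub_self]
  have hhg : h ∘ₗ g = 0 := by
    refine TensorProduct.ext' fun a p => ?_
    rw [LinearMap.comp_apply, hg, hh, hβα, ← symMul_apply, map_zero]
    rfl
  refine ⟨?_, fun x => ⟨fun hx => ?_, ?_⟩, fun z => ⟨fun hz => ?_, ?_⟩, ?_⟩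
  · have hw := injective_of_exteriorSquare_antisymmetrization (r.lTensor Q ∘ₗ f) fun a b => by
      simp [hf, hrα]
    exact Function.Injective.of_comp hw
  · let B : P →ₗ[k] P →ₗ[k] Q ⊗[k] T :=
      (TensorProduct.mk k Q T).compl₁₂ r β + ((TensorProduct.mk k Q T).compl₁₂ r β).flip
    have hB (u v : P) : B u v = B v u := by
      simp [B, add_comm]
    have hBg : symLift B hB ∘ₗ g = β.lTensor Q :=
      TensorProduct.ext' fun a p => by
        rw [LinearMap.comp_apply, hg, symLift_symMk]
        simp [B, hrα, hβα]
    have hx' : β.lTensor Q x = 0 := by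
      rw [← hBg, LinearMap.comp_apply, hx, map_zero]
    obtain ⟨y, rfl⟩ := (lTensor_exact Q hαβ hβ x).1 hx'
    have hrg : symMap r ∘ₗ g ∘ₗ α.lTensor Q = (symSub k Q).mkQ :=
      TensorProduct.ext' fun a b => by
        rw [LinearMap.comp_apply, LinearMap.comp_apply, LinearMap.lTensor_tmul, hg,
          symMap_symMk, hrα, hrα]
        rfl
    have hy : y ∈ symSub k Q := by
      rw [← Submodule.Quotient.mk_eq_zero, ← Submodule.mkQ_apply, ← hrg, LinearMap.comp_apply,
        LinearMap.comp_apply, hx, map_zero]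
    have hle : symSub k Q ≤ (LinearMap.range f).comap (α.lTensor Q) := by
      refine Submodule.span_le.2 ?_
      rintro _ ⟨u, v, rfl⟩
      exact ⟨exteriorPower.ιMulti k 2 ![u, v], by simp [hf]⟩
    exact hle hy
  · rintro ⟨y, rfl⟩
    exact LinearMap.congr_fun hgf y
  · have hmk : (LinearMap.range g).mkQ ∘ₗ symMap s ∘ₗ h = (LinearMap.range g).mkQ := by
      refine sym2_hom_ext fun p p' => ?_
      have hlift (p : P) : ∃ a, α a = s (β p) - p := (hαβ _).1 (by simp [hβs])
      obtain ⟨a, ha⟩ := hlift p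
      obtain ⟨a', ha'⟩ := hlift p'
      rw [LinearMap.comp_apply, LinearMap.comp_apply, hh, symMap_symMk, Submodule.mkQ_apply,
        Submodule.mkQ_apply, Submodule.Quotient.eq]
      refine ⟨a ⊗ₜ s (β p') + a' ⊗ₜ p, ?_⟩
      rw [map_add, hg, hg, ha, ha', symMk_comm _ p]
      simp only [← symMul_apply, map_sub, LinearMap.sub_apply]
      abel
    have := LinearMap.congr_fun hmk z
    rw [LinearMap.comp_apply, LinearMap.comp_apply, hz, map_zero, map_zero] at this
    exact (Submodule.Quotient.mk_eq_zero _).1 this.symm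
  · rintro ⟨y, rfl⟩
    exact LinearMap.congr_fun hhg y
  · have hid : h ∘ₗ symMap s = LinearMap.id := sym2_hom_ext fun t t' => by
      rw [LinearMap.comp_apply, symMap_symMk, hh, hβs, hβs]
      rfl
    exact Function.RightInverse.surjective (g := symMap s) fun x => LinearMap.congr_fun hid x

end ExactSequence

/-- An additive map between `ℤ`-modules as a linear map, for arbitrary `ℤ`-module instances. -/
def intLinearMap {M N : Type*} [AddCommGroup M] {_ : Module ℤ M}
    [AddCommGroup N] {_ : Module ℤ N}
    (φ : M →+ N) : M →ₗ[ℤ] N where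
  toFun := φ
  map_add' := map_add φ
  map_smul' := map_intCast_smul φ ℤ ℤ

/-- **Statement 10.** Let `0 → Q --α--> P --β--> T → 0` be a short exact sequence of finitely
generated free abelian groups.  Then the sequence
`0 → Λ²Q → Q ⊗ P → S²(P) → S²(T) → 0` is exact, where `Λ²Q → Q ⊗ P` sends `a∧b` to
`a ⊗ α(b) − b ⊗ α(a)`, `Q ⊗ P → S²(P)` sends `a ⊗ p` to `α(a)·p`, and `S²(P) → S²(T)` is
induced by `β`. -/
theorem statement10 {Q P T : Type*}
    [AddCommGroup Q] [Module ℤ Q] [Module.Free ℤ Q] [Module.Finite ℤ Q]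
    [AddCommGroup P] [Module ℤ P] [Module.Free ℤ P] [Module.Finite ℤ P]
    [AddCommGroup T] [Module ℤ T] [Module.Free ℤ T] [Module.Finite ℤ T]
    (α : Q →ₗ[ℤ] P) (β : P →ₗ[ℤ] T)
    (hα : Function.Injective α) (hβ : Function.Surjective β)
    (hαβ : Function.Exact α β)
    (f : ⋀[ℤ]^2 Q →ₗ[ℤ] Q ⊗[ℤ] P) (g : Q ⊗[ℤ] P →ₗ[ℤ] Sym2M ℤ P)
    (h : Sym2M ℤ P →ₗ[ℤ] Sym2M ℤ T)
    (hf : ∀ a b : Q, f (wedge2 a b) = a ⊗ₜ[ℤ] α b - b ⊗ₜ[ℤ] α a)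
    (hg : ∀ (a : Q) (p : P), g (a ⊗ₜ[ℤ] p) = symMk (α a) p)
    (hh : ∀ p p' : P, h (symMk p p') = symMk (β p) (β p')) :
    Function.Injective f ∧ Function.Exact f g ∧ Function.Exact g h ∧
      Function.Surjective h := by
  exact sym2_koszul_exact α β hα hβ hαβ (intLinearMap f.toAddMonoidHom)
    (intLinearMap g.toAddMonoidHom) (intLinearMap h.toAddMonoidHom) hf hg hh

end
end

section
/- Let G be a finite group of odd order, let P be a finitely generated free ℤ[G]-module, and let A be any G-module. Then Hⁱ(G, S²(P) ⊗ℤ A) = 0 for all i ≥ 1, where G acts diagonally on S²(P) ⊗ℤ A. -/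
noncomputable section

open QuaternionGroup Finsupp TensorProduct

/-- If a set is mapped into its span by `f`, then the span is `f`-stable. -/
theorem Submodule.span_stable {k V : Type*} [CommRing k] [AddCommGroup V] [Module k V]
    {f : V →ₗ[k] V} {s : Set V} (h : ∀ x ∈ s, f x ∈ Submodule.span k s) :
    ∀ v ∈ Submodule.span k s, f v ∈ Submodule.span k s := by
  intro v hv
  have h2 : (Submodule.span k s).map f ≤ Submodule.span k s := by
    rw [Submodule.map_span, Submodule.span_le]
    rintro _ ⟨x, hx, rfl⟩
    exact h x hx
  exact h2 ⟨v, hv, rfl⟩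

/-- The representation induced on the quotient by a stable submodule. -/
def Representation.quot {k G V : Type*} [CommRing k] [Monoid G] [AddCommGroup V] [Module k V]
    (ρ : Representation k G V) (W : Submodule k V) (h : ∀ g, ∀ v ∈ W, ρ g v ∈ W) :
    Representation k G (V ⧸ W) where
  toFun g := W.mapQ W (ρ g) (fun v hv => h g v hv)
  map_one' := by
    refine Submodule.linearMap_qext _ ?_
    ext v
    simp
  map_mul' g₁ g₂ := by
    refine Submodule.linearMap_qext _ ?_
    ext v
    simp [Submodule.mapQ_apply]

/-- The representation induced on a stable submodule. -/
def Representation.subrep {k G V : Type*} [CommRing k] [Monoid G] [AddCommGroup V] [Module k V]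
    (ρ : Representation k G V) (W : Submodule k V) (h : ∀ g, ∀ v ∈ W, ρ g v ∈ W) :
    Representation k G W where
  toFun g := (ρ g).restrict (fun v hv => h g v hv)
  map_one' := by
    ext v
    simp [LinearMap.restrict_apply]
  map_mul' g₁ g₂ := by
    ext v
    simp [LinearMap.restrict_apply]

section Sym2

variable (k : Type*) [CommRing k] (V : Type*) [AddCommGroup V] [Module k V]

variable {k V}

theorem symSub_stable {G : Type*} [Monoid G] (ρ : Representation k G V) :
    ∀ g, ∀ w ∈ symSub k V, (ρ.tprod ρ) g w ∈ symSub k V := by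
  intro g
  refine Submodule.span_stable ?_
  rintro _ ⟨u, v, rfl⟩
  rw [map_sub]
  exact Submodule.subset_span ⟨ρ g u, ρ g v, by simp [Representation.tprod_apply]⟩

/-- The induced representation on the symmetric square. -/
def sym2Rep {G : Type*} [Monoid G] (ρ : Representation k G V) :
    Representation k G (Sym2M k V) :=
  (ρ.tprod ρ).quot (symSub k V) (symSub_stable ρ)

end Sym2

open CategoryTheory

/-- A representation `ρ` of a finite group is relatively projective if the identity is the trace
`∑ g, ρ g ∘ T ∘ ρ g⁻¹` of some linear endomorphism `T`. -/
def Representation.IsRelativelyProjective {k G V : Type*} [CommRing k] [Group G] [Fintype G]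
    [AddCommGroup V] [Module k V] (ρ : Representation k G V) : Prop :=
  ∃ T : V →ₗ[k] V, ∀ v, ∑ g, ρ g (T (ρ g⁻¹ v)) = v

namespace Representation.IsRelativelyProjective

/-- A linear endomorphism of trace `1` splits the canonical embedding of a representation into the
representation coinduced from the trivial subgroup. -/
def retraction {k G V : Type*} [CommRing k] [Group G] [Fintype G]
    [AddCommGroup V] [Module k V] (ρ : Representation k G V) (T : V →ₗ[k] V) :
    (Representation.coind (⊥ : Subgroup G).subtype (ρ.comp (⊥ : Subgroup G).subtype)).IntertwiningMap
      ρ where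
  toLinearMap := ∑ g, ρ g ∘ₗ T ∘ₗ LinearMap.proj g⁻¹ ∘ₗ Submodule.subtype _
  isIntertwining' h := by
    ext f
    simp only [LinearMap.comp_apply, LinearMap.sum_apply, map_sum]
    refine (Fintype.sum_equiv (Equiv.mulLeft h) _ _ fun g => ?_).symm
    have hf : f.1 g⁻¹ = f.1 (g⁻¹ * h⁻¹ * h) := by simp
    simp only [Equiv.coe_mulLeft, map_mul, Module.End.mul_apply, mul_inv_rev, LinearMap.proj_apply,
      Submodule.subtype_apply]
    exact congrArg (fun x => ρ h (ρ g (T x))) hf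

theorem subsingleton_groupCohomology_succ {k G : Type} [CommRing k] [Group G] [Fintype G]
    {V : Type} [AddCommGroup V] [Module k V] {ρ : Representation k G V}
    (h : ρ.IsRelativelyProjective) (n : ℕ) :
    Subsingleton (groupCohomology (Rep.of ρ) (n + 1)) := by
  obtain ⟨T, hT⟩ := h
  let ι : Rep.of ρ ⟶ Rep.coind (⊥ : Subgroup G).subtype
      (Rep.res (⊥ : Subgroup G).subtype (Rep.of ρ)) := Rep.resCoindToHom _ _ _ (𝟙 _)
  let π : Rep.coind (⊥ : Subgroup G).subtype
      (Rep.res (⊥ : Subgroup G).subtype (Rep.of ρ)) ⟶ Rep.of ρ := Rep.ofHom (retraction ρ T)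
  have hιπ : ι ≫ π = 𝟙 _ := by
    ext v
    refine Eq.trans ?_ (hT v)
    exact LinearMap.sum_apply _ _ _
  have hz : Limits.IsZero (groupCohomology (Rep.coind (⊥ : Subgroup G).subtype
      (Rep.res (⊥ : Subgroup G).subtype (Rep.of ρ))) (n + 1)) :=
    (isZero_groupCohomology_succ_of_subsingleton _ n).of_iso (groupCohomology.coindIso _ _)
  have hz' : Limits.IsZero (groupCohomology (Rep.of ρ) (n + 1)) := by
    have hid := congrArg (groupCohomology.functor k G (n + 1)).map hιπ
    rw [CategoryTheory.Functor.map_comp, CategoryTheory.Functor.map_id] at hid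
    refine (Limits.IsZero.iff_id_eq_zero _).2 (hid.symm.trans ?_)
    exact (congrArg (· ≫ _) (hz.eq_of_tgt _ 0)).trans Limits.zero_comp
  exact ModuleCat.subsingleton_of_isZero hz'

variable {k G V W : Type*} [CommRing k] [Group G] [Fintype G]
  [AddCommGroup V] [Module k V] [AddCommGroup W] [Module k W]

theorem tprod_left {ρ : Representation k G V} (h : ρ.IsRelativelyProjective)
    (σ : Representation k G W) : (ρ.tprod σ).IsRelativelyProjective := by
  obtain ⟨T, hT⟩ := h
  refine ⟨T.rTensor W, fun x => ?_⟩
  induction x with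
  | zero => simp
  | add x y hx hy =>
    simp only [map_add, Finset.sum_add_distrib, hx, hy]
  | tmul v w =>
    simp [Representation.tprod_apply, ← TensorProduct.sum_tmul, hT]

theorem of_free {ρ : Representation k G V}
    (h : Module.Free (MonoidAlgebra k G) ρ.asModule) : ρ.IsRelativelyProjective := by
  classical
  let b := Module.Free.chooseBasis (MonoidAlgebra k G) ρ.asModule
  let E : MonoidAlgebra k G →ₗ[k] MonoidAlgebra k G :=
    { toFun := fun x => MonoidAlgebra.single 1 (x.coeff 1)
      map_add' := by simp [MonoidAlgebra.single_add]
      map_smul' := by simp }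
  let r : V →ₗ[k] _ := b.repr.toLinearMap.restrictScalars k ∘ₗ ρ.asModuleEquiv.symm.toLinearMap
  let s : _ →ₗ[k] V := ρ.asModuleEquiv.toLinearMap ∘ₗ b.repr.symm.toLinearMap.restrictScalars k
  have hr (g : G) (v : V) : r (ρ g v) = MonoidAlgebra.single g (1 : k) • r v := by
    change b.repr (ρ.asModuleEquiv.symm (ρ g v)) = _
    rw [Representation.asModuleEquiv_symm_map_rho, map_smul]
    rfl
  have hrs x : r (s x) = x := by simp [r, s]
  have hinj : Function.Injective r := fun x y hxy => by simpa [r] using hxy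
  refine ⟨s ∘ₗ Finsupp.mapRange.linearMap E ∘ₗ r, fun v => hinj ?_⟩
  ext i g
  have hE (x : MonoidAlgebra k G) (y : G) : (E x).coeff y = if y = 1 then x.coeff 1 else 0 := by
    change (Finsupp.single 1 (x.coeff 1) : G →₀ k) y = _
    rw [Finsupp.single_apply]
    simp only [eq_comm]
  simp [hr, hrs, hE, inv_mul_eq_one]

/-- The midpoint of two elements of a group of odd order `n`: the element `m` such that
`b⁻¹ * m = m⁻¹ * a`. -/
def _root_.oddMidpoint (a b : G) : G := b * (b⁻¹ * a) ^ ((Fintype.card G + 1) / 2)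

theorem _root_.oddMidpoint_mul_left (g a b : G) :
    oddMidpoint (g * a) (g * b) = g * oddMidpoint a b := by
  simp [oddMidpoint, mul_assoc]

theorem _root_.oddMidpoint_comm (hodd : Odd (Fintype.card G)) (a b : G) :
    oddMidpoint a b = oddMidpoint b a := by
  obtain ⟨m, hm⟩ := hodd
  have hk : (Fintype.card G + 1) / 2 = m + 1 := by omega
  have hpow : (b⁻¹ * a) ^ (m + 1) * (b⁻¹ * a) ^ (m + 1) = b⁻¹ * a := by
    rw [← pow_add, show m + 1 + (m + 1) = Fintype.card G + 1 by omega, pow_succ, pow_card_eq_one,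
      one_mul]
  have hinv : a⁻¹ * b = (b⁻¹ * a)⁻¹ := by group
  rw [oddMidpoint, oddMidpoint, hk, hinv, inv_pow, eq_mul_inv_iff_mul_eq, mul_assoc, hpow,
    mul_inv_cancel_left]

theorem sym2Rep {ρ : Representation k G V} (hodd : Odd (Fintype.card G))
    (h : ρ.IsRelativelyProjective) : (_root_.sym2Rep ρ).IsRelativelyProjective := by
  classical
  obtain ⟨T, hT⟩ := h
  let π : G → V →ₗ[k] V := fun a => ρ a ∘ₗ T ∘ₗ ρ a⁻¹
  let D : V ⊗[k] V →ₗ[k] V ⊗[k] V :=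
    ∑ a, ∑ b, if oddMidpoint a b = 1 then TensorProduct.map (π a) (π b) else 0
  have hDtmul (u v : V) : D (u ⊗ₜ v) =
      ∑ a, ∑ b, if oddMidpoint a b = 1 then π a u ⊗ₜ[k] π b v else 0 := by
    simp only [D, LinearMap.sum_apply]
    refine Finset.sum_congr rfl fun a _ => Finset.sum_congr rfl fun b _ => ?_
    split_ifs <;> simp
  have hD : ∀ w ∈ symSub k V, D w ∈ symSub k V := by
    refine Submodule.span_stable ?_
    rintro _ ⟨u, v, rfl⟩
    rw [map_sub, hDtmul, hDtmul v u, Finset.sum_comm (f := fun a b =>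
      if oddMidpoint a b = 1 then π a v ⊗ₜ[k] π b u else 0), ← Finset.sum_sub_distrib]
    refine Submodule.sum_mem _ fun a _ => ?_
    rw [← Finset.sum_sub_distrib]
    refine Submodule.sum_mem _ fun b _ => ?_
    rw [oddMidpoint_comm hodd b a]
    split_ifs
    · exact Submodule.subset_span ⟨_, _, rfl⟩
    · simp
  have hconj (g a : G) (u : V) : ρ g (π a (ρ g⁻¹ u)) = π (g * a) u := by
    simp [π]
  have htrace (x : V ⊗[k] V) : ∑ g, (ρ.tprod ρ) g (D ((ρ.tprod ρ) g⁻¹ x)) = x := by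
    induction x with
    | zero => simp
    | add x y hx hy => simp only [map_add, Finset.sum_add_distrib, hx, hy]
    | tmul u v =>
      have hg (g : G) : (ρ.tprod ρ) g (D ((ρ.tprod ρ) g⁻¹ (u ⊗ₜ v))) =
          ∑ a, ∑ b, if oddMidpoint a b = g then π a u ⊗ₜ[k] π b v else 0 := by
        rw [Representation.tprod_apply, Representation.tprod_apply, TensorProduct.map_tmul, hDtmul,
          map_sum]
        refine Fintype.sum_equiv (Equiv.mulLeft g) _ _ fun a => ?_
        rw [map_sum]
        refine Fintype.sum_equiv (Equiv.mulLeft g) _ _ fun b => ?_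
        simp only [Equiv.coe_mulLeft, oddMidpoint_mul_left, mul_eq_left]
        split_ifs
        · rw [TensorProduct.map_tmul, hconj, hconj]
        · simp
      simp only [hg]
      rw [Finset.sum_comm]
      have hu : ∑ a, π a u = u := hT u
      have hv : ∑ b, π b v = v := hT v
      conv_rhs => rw [← hu, ← hv, TensorProduct.sum_tmul]
      refine Finset.sum_congr rfl fun a _ => ?_
      rw [Finset.sum_comm, TensorProduct.tmul_sum]
      simp
  refine ⟨(symSub k V).mapQ (symSub k V) D hD, fun x => ?_⟩
  obtain ⟨x, rfl⟩ := Submodule.Quotient.mk_surjective _ x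
  conv_rhs => rw [← htrace x]
  exact (map_sum (symSub k V).mkQ _ _).symm

end Representation.IsRelativelyProjective

/-- **Statement 13.** Let `G` be a finite group of odd order, let `P` be a finitely generated
free `ℤ[G]`-module, and let `A` be any `G`-module.  Then `Hⁱ(G, S²(P) ⊗ℤ A) = 0` for all
`i ≥ 1`, where `G` acts diagonally on `S²(P) ⊗ℤ A`. -/
theorem statement13 {G : Type} [Group G] [Fintype G] (hodd : Odd (Fintype.card G))
    {P : Type} [AddCommGroup P] (ρP : Representation ℤ G P)
    (hfree : Module.Free (MonoidAlgebra ℤ G) ρP.asModule)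
    (hfin : Module.Finite (MonoidAlgebra ℤ G) ρP.asModule)
    {A : Type} [AddCommGroup A] (ρA : Representation ℤ G A) :
    ∀ i : ℕ, 1 ≤ i →
      Subsingleton (groupCohomology (Rep.of ((sym2Rep ρP).tprod ρA)) i) := by
  intro i hi
  obtain ⟨n, rfl⟩ := Nat.exists_eq_add_of_le' hi
  exact (((Representation.IsRelativelyProjective.of_free hfree).sym2Rep hodd).tprod_left
    ρA).subsingleton_groupCohomology_succ n

end
end
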